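/- For every real number q with 0 < q < 1, one has 1 + ∑_{n=1}^∞ q^{n(n+1)} / ((1−q)(1−q²)⋯(1−q^n)) = ∏_{n=1}^∞ 1/((1−q^{5n−2})(1−q^{5n−3})) (the second Rogers–Ramanujan identity). -/

import Mathlib

open Filter Topology

/-- The finite product `(x;x)_n`. -/
noncomputable def qp (x : ℝ) (n : ℕ) : ℝ := ∏ j ∈ Finset.range n, (1 - x ^ (j + 1))

theorem qp_zero (x : ℝ) : qp x 0 = 1 := by simp [qp]

theorem qp_succ (x : ℝ) (n : ℕ) : qp x (n + 1) = qp x n * (1 - x ^ (n + 1)) := by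
  simp [qp, Finset.prod_range_succ]

theorem fac_pos {x : ℝ} (h0 : 0 < x) (h1 : x < 1) (n : ℕ) : 0 < 1 - x ^ (n + 1) := by
  have := pow_lt_one₀ h0.le h1 (show n + 1 ≠ 0 by omega)
  linarith

theorem qp_pos {x : ℝ} (h0 : 0 < x) (h1 : x < 1) (n : ℕ) : 0 < qp x n :=
  Finset.prod_pos fun j _ => fac_pos h0 h1 j

theorem tri (n : ℕ) : 2 * Nat.choose (n + 1) 2 = n * (n + 1) := by
  induction n with
  | zero => rfl
  | succ n ih =>
    rw [Nat.choose_succ_succ' (n + 1) 1, Nat.choose_one_right]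
    linarith

theorem tri_succ (n : ℕ) : Nat.choose (n + 1) 2 = n + Nat.choose n 2 := by
  rw [Nat.choose_succ_succ' n 1, Nat.choose_one_right]

theorem split_sum (M : ℕ) (f g : ℕ → ℝ) (hf : f (M + 1) = 0) (hg : g 0 = 0) :
    ∑ i ∈ Finset.range (M + 2), (f i + g i) =
      ∑ i ∈ Finset.range (M + 1), f i + ∑ i ∈ Finset.range (M + 1), g (i + 1) := by
  rw [Finset.sum_add_distrib, Finset.sum_range_succ f, Finset.sum_range_succ' g, hf, hg]
  ring

/-- q-Vandermonde. -/
theorem vander {q : ℝ} (h0 : 0 < q) (h1 : q < 1) (M : ℕ) : ∀ c : ℕ,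
    ∑ t ∈ Finset.range (M + 1), q ^ (t ^ 2 + c * t) / (qp q (M - t) * qp q t * qp q (t + c)) =
      1 / (qp q M * qp q (M + c)) := by
  have hp : ∀ n, qp q n ≠ 0 := fun n => (qp_pos h0 h1 n).ne'
  have hf : ∀ n, 1 - q ^ (n + 1) ≠ 0 := fun n => (fac_pos h0 h1 n).ne'
  induction M with
  | zero => intro c; simp [qp_zero]
  | succ M ih =>
    intro c
    have key : (1 - q ^ (M + 1)) * ∑ t ∈ Finset.range (M + 1 + 1),
        q ^ (t ^ 2 + c * t) / (qp q (M + 1 - t) * qp q t * qp q (t + c)) =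
        1 / (qp q M * qp q (M + c)) + q ^ (M + c + 1) * (1 / (qp q M * qp q (M + (c + 1)))) := by
      rw [← ih c, ← ih (c + 1), Finset.mul_sum, Finset.mul_sum]
      have := split_sum M
        (fun t => (1 - q ^ (M + 1 - t)) *
          (q ^ (t ^ 2 + c * t) / (qp q (M + 1 - t) * qp q t * qp q (t + c))))
        (fun t => q ^ (M + 1 - t) * (1 - q ^ t) *
          (q ^ (t ^ 2 + c * t) / (qp q (M + 1 - t) * qp q t * qp q (t + c))))
        (by simp) (by simp)
      convert this using 1
      · refine Finset.sum_congr rfl fun t ht => ?_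
        have ht : t ≤ M + 1 := by simp at ht; omega
        have : q ^ (M + 1) = q ^ (M + 1 - t) * q ^ t := by
          rw [← pow_add]; congr 1; omega
        rw [this]; ring
      · congr 1
        · refine Finset.sum_congr rfl fun t ht => ?_
          obtain ⟨k, rfl⟩ : ∃ k, M = t + k := ⟨M - t, by simp at ht; omega⟩
          have e1 : t + k + 1 - t = k + 1 := by omega
          have e2 : t + k - t = k := by omega
          simp only [e1, e2, qp_succ]
          have := hp k; have := hp t; have := hp (t + c); have := hf k
          field_simp
        · refine Finset.sum_congr rfl fun t ht => ?_
          obtain ⟨k, rfl⟩ : ∃ k, M = t + k := ⟨M - t, by simp at ht; omega⟩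
          have e1 : t + k + 1 - (t + 1) = k := by omega
          have e2 : t + k - t = k := by omega
          have e3 : t + 1 + c = t + (c + 1) := by omega
          simp only [e1, e2, e3, qp_succ q t]
          have := hp k; have := hp t; have := hp (t + (c + 1)); have := hf t
          field_simp
          ring
    have h2 : 1 / (qp q M * qp q (M + c)) + q ^ (M + c + 1) * (1 / (qp q M * qp q (M + (c + 1))))
        = (1 - q ^ (M + 1)) * (1 / (qp q (M + 1) * qp q (M + 1 + c))) := by
      have e : M + 1 + c = M + c + 1 := by omega
      rw [← add_assoc, e, qp_succ q M, qp_succ q (M + c)]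
      have := hp M; have := hp (M + c); have := hf M; have := hf (M + c)
      field_simp
      ring
    rw [h2] at key
    exact mul_left_cancel₀ (hf M) key

theorem unit_part {q : ℝ} (h0 : 0 < q) (h1 : q < 1) (n J : ℕ) (hJ : J ≤ n) :
    ∑ j ∈ Finset.range (J + 1), (-1) ^ j * q ^ (Nat.choose j 2) * (1 - q ^ (2 * j + 1)) /
      (qp q (n + 1 - j) * qp q (n + 1 + j + 1)) =
    (-1) ^ J * q ^ (Nat.choose (J + 1) 2) * (1 - q ^ (J + 1)) /
      (qp q (n - J) * qp q (n + 1 + J + 1) * (1 - q ^ (n + 1))) := by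
  have hp : ∀ n, qp q n ≠ 0 := fun n => (qp_pos h0 h1 n).ne'
  have hf : ∀ n, 1 - q ^ (n + 1) ≠ 0 := fun n => (fac_pos h0 h1 n).ne'
  induction J with
  | zero =>
    simp [qp_succ q n]
    have := hp n; have := hf n; have := hp (n + 1 + 1)
    field_simp
  | succ J ih =>
    rw [Finset.sum_range_succ, ih (by omega)]
    obtain ⟨k, rfl⟩ : ∃ k, n = J + 1 + k := ⟨n - (J + 1), by omega⟩
    have e1 : J + 1 + k - J = k + 1 := by omega
    have e2 : J + 1 + k + 1 - (J + 1) = k + 1 := by omega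
    have e3 : J + 1 + k - (J + 1) = k := by omega
    have e4 : J + 1 + k + 1 + (J + 1) + 1 = (J + 1 + k + 1 + J + 1) + 1 := by omega
    rw [e1, e2, e3, e4, qp_succ q k, qp_succ q (J + 1 + k + 1 + J + 1), tri_succ (J + 1)]
    have := hp k; have := hf k; have := hp (J + 1 + k + 1 + J + 1); have := hf (J + 1 + k)
    have := hf (J + 1 + k + 1 + J + 1)
    field_simp
    ring

theorem unit_pair {q : ℝ} (h0 : 0 < q) (h1 : q < 1) (n : ℕ) :
    ∑ j ∈ Finset.range (n + 1), (-1) ^ j * q ^ (Nat.choose j 2) * (1 - q ^ (2 * j + 1)) /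
      (qp q (n - j) * qp q (n + j + 1)) = if n = 0 then 1 else 0 := by
  have hp : ∀ n, qp q n ≠ 0 := fun n => (qp_pos h0 h1 n).ne'
  have hf : ∀ n, 1 - q ^ (n + 1) ≠ 0 := fun n => (fac_pos h0 h1 n).ne'
  cases n with
  | zero =>
    have := hf 0
    simp [qp_zero, qp_succ] at *
    field_simp
    exact this
  | succ n =>
    rw [Finset.sum_range_succ, unit_part h0 h1 n n le_rfl]
    have e1 : n + 1 + (n + 1) + 1 = (n + 1 + n + 1) + 1 := by omega
    have := hp (n + 1 + n + 1); have := hf (n + 1 + n + 1); have := hf n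
    simp only [e1, Nat.sub_self, qp_zero, qp_succ q (n + 1 + n + 1)]
    simp
    field_simp
    ring

/-- Bailey's lemma (one step). -/
theorem bailey {q : ℝ} (h0 : 0 < q) (h1 : q < 1) (α β : ℕ → ℝ)
    (h : ∀ n, ∑ j ∈ Finset.range (n + 1), α j / (qp q (n - j) * qp q (n + j + 1)) = β n) (N : ℕ) :
    ∑ j ∈ Finset.range (N + 1), (q ^ (j ^ 2 + j) * α j) / (qp q (N - j) * qp q (N + j + 1)) =
      ∑ s ∈ Finset.range (N + 1), q ^ (s ^ 2 + s) * β s / qp q (N - s) := by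
  simp_rw [← h, Finset.mul_sum, Finset.sum_div]
  rw [Finset.range_eq_Ico]
  simp_rw [Finset.range_eq_Ico]
  have hc := Finset.sum_Ico_Ico_comm 0 (N + 1) (fun j s : ℕ =>
    q ^ (s ^ 2 + s) * (α j / (qp q (s - j) * qp q (s + j + 1))) / qp q (N - s))
  rw [← hc]
  refine Finset.sum_congr rfl fun j hj => ?_
  obtain ⟨M, rfl⟩ : ∃ k, N = j + k := ⟨N - j, by simp at hj; omega⟩
  have hv := vander h0 h1 M (2 * j + 1)
  have e1 : j + M - j = M := by omega
  have e2 : j + M + j + 1 = M + (2 * j + 1) := by omega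
  rw [e1, e2, div_eq_mul_one_div, ← hv, Finset.sum_Ico_eq_sum_range, Finset.mul_sum]
  have e3 : j + M + 1 - j = M + 1 := by omega
  rw [e3]
  refine Finset.sum_congr rfl fun t ht => ?_
  have e4 : j + M - (j + t) = M - t := by omega
  have e5 : j + t - j = t := by omega
  have e6 : j + t + j + 1 = t + (2 * j + 1) := by omega
  rw [e4, e5, e6]
  ring

theorem finite_rr {q : ℝ} (h0 : 0 < q) (h1 : q < 1) (N : ℕ) :
    ∑ j ∈ Finset.range (N + 1), (q ^ (j ^ 2 + j) * (q ^ (j ^ 2 + j) *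
        ((-1) ^ j * q ^ (Nat.choose j 2) * (1 - q ^ (2 * j + 1))))) /
          (qp q (N - j) * qp q (N + j + 1)) =
      ∑ s ∈ Finset.range (N + 1), q ^ (s ^ 2 + s) * (1 / qp q s) / qp q (N - s) := by
  refine bailey h0 h1 _ _ (fun n => ?_) N
  rw [bailey h0 h1 _ _ (unit_pair h0 h1) n, Finset.sum_range_succ', Finset.sum_eq_zero]
  · simp
  · intro s _; simp

theorem cauchy_binom {x : ℝ} (h0 : 0 < x) (h1 : x < 1) (a : ℝ) (n : ℕ) :
    ∏ k ∈ Finset.range n, (a - x ^ k) = qp x n * ∑ i ∈ Finset.range (n + 1),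
      (-1) ^ i * a ^ (n - i) * x ^ (Nat.choose i 2) / (qp x i * qp x (n - i)) := by
  have hp : ∀ n, qp x n ≠ 0 := fun n => (qp_pos h0 h1 n).ne'
  have hf : ∀ n, 1 - x ^ (n + 1) ≠ 0 := fun n => (fac_pos h0 h1 n).ne'
  induction n with
  | zero => simp [qp_zero]
  | succ n ih =>
    rw [Finset.prod_range_succ, ih, qp_succ, mul_assoc, mul_assoc]
    congr 1
    have := split_sum n
      (fun i => (1 - x ^ (n + 1 - i)) *
        ((-1) ^ i * a ^ (n + 1 - i) * x ^ (Nat.choose i 2) / (qp x i * qp x (n + 1 - i))))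
      (fun i => x ^ (n + 1 - i) * (1 - x ^ i) *
        ((-1) ^ i * a ^ (n + 1 - i) * x ^ (Nat.choose i 2) / (qp x i * qp x (n + 1 - i))))
      (by simp) (by simp)
    symm
    rw [Finset.mul_sum, mul_sub, Finset.sum_mul, Finset.sum_mul,
      sub_eq_add_neg (∑ i ∈ Finset.range (n + 1), _), ← Finset.sum_neg_distrib]
    convert this using 1
    · refine Finset.sum_congr rfl fun t ht => ?_
      have ht : t ≤ n + 1 := by simp at ht; omega
      have : x ^ (n + 1) = x ^ (n + 1 - t) * x ^ t := by
        rw [← pow_add]; congr 1; omega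
      rw [this]; ring
    · congr 1
      · refine Finset.sum_congr rfl fun t ht => ?_
        obtain ⟨k, rfl⟩ : ∃ k, n = t + k := ⟨n - t, by simp at ht; omega⟩
        have e1 : t + k + 1 - t = k + 1 := by omega
        have e2 : t + k - t = k := by omega
        simp only [e1, e2, qp_succ]
        have := hp k; have := hp t; have := hf k
        field_simp
        try ring
      · refine Finset.sum_congr rfl fun t ht => ?_
        obtain ⟨k, rfl⟩ : ∃ k, n = t + k := ⟨n - t, by simp at ht; omega⟩
        have e1 : t + k + 1 - (t + 1) = k := by omega
        have e2 : t + k - t = k := by omega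
        simp only [e1, e2, qp_succ x t, tri_succ]
        have := hp k; have := hp t; have := hf t
        field_simp
        ring

theorem prod_side {q : ℝ} (N : ℕ) :
    ∏ k ∈ Finset.range (2 * N + 1), (q ^ (5 * N + 1) - (q ^ 5) ^ k) =
      (-1) ^ (N + 1) * q ^ (5 * Nat.choose (N + 1) 2 + (5 * N + 1) * N) *
      ((∏ n ∈ Finset.range N, ((1 - q ^ (5 * n + 1)) * (1 - q ^ (5 * n + 4)))) *
        (1 - q ^ (5 * N + 1))) := by
  have hs : 2 * N + 1 = (N + 1) + N := by omega
  rw [hs, Finset.prod_range_add, Finset.prod_mul_distrib]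
  have A : ∏ k ∈ Finset.range (N + 1), (q ^ (5 * N + 1) - (q ^ 5) ^ k) =
      (-1) ^ (N + 1) * q ^ (5 * Nat.choose (N + 1) 2) *
        ((∏ n ∈ Finset.range N, (1 - q ^ (5 * n + 1))) * (1 - q ^ (5 * N + 1))) := by
    rw [← Finset.prod_range_succ (fun n => 1 - q ^ (5 * n + 1)),
      ← Finset.prod_range_reflect (fun n => 1 - q ^ (5 * n + 1))]
    have hc : q ^ (5 * Nat.choose (N + 1) 2) = ∏ k ∈ Finset.range (N + 1), (q ^ 5) ^ k := by
      rw [Finset.prod_pow_eq_pow_sum, Finset.sum_range_id, ← Nat.choose_two_right, ← pow_mul]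
    have hm : (-1 : ℝ) ^ (N + 1) = ∏ k ∈ Finset.range (N + 1), (-1 : ℝ) := by simp
    rw [hc, hm, ← Finset.prod_mul_distrib, ← Finset.prod_mul_distrib]
    refine Finset.prod_congr rfl fun k hk => ?_
    obtain ⟨m, rfl⟩ : ∃ m, N = k + m := ⟨N - k, by simp at hk; omega⟩
    have e : k + m + 1 - 1 - k = m := by omega
    rw [e]; ring
  have B : ∏ k ∈ Finset.range N, (q ^ (5 * N + 1) - (q ^ 5) ^ (N + 1 + k)) =
      q ^ ((5 * N + 1) * N) * ∏ n ∈ Finset.range N, (1 - q ^ (5 * n + 4)) := by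
    have hm : q ^ ((5 * N + 1) * N) = ∏ k ∈ Finset.range N, q ^ (5 * N + 1) := by
      simp [pow_mul]
    rw [hm, ← Finset.prod_mul_distrib]
    refine Finset.prod_congr rfl fun k hk => ?_
    ring
  rw [A, B, pow_add q]
  ring

theorem finite_jtp {q : ℝ} (h0 : 0 < q) (h1 : q < 1) (N : ℕ) :
    (∏ n ∈ Finset.range N, ((1 - q ^ (5 * n + 1)) * (1 - q ^ (5 * n + 4)))) *
        (1 - q ^ (5 * N + 1)) =
      ∑ j ∈ Finset.range (N + 1), (q ^ (j ^ 2 + j) * (q ^ (j ^ 2 + j) *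
        ((-1) ^ j * q ^ (Nat.choose j 2) * (1 - q ^ (2 * j + 1))))) *
          (qp (q ^ 5) (2 * N + 1) / (qp (q ^ 5) (N - j) * qp (q ^ 5) (N + j + 1))) := by
  have h0' : 0 < q ^ 5 := by positivity
  have h1' : q ^ 5 < 1 := pow_lt_one₀ h0.le h1 (by norm_num)
  have hp : ∀ n, qp (q ^ 5) n ≠ 0 := fun n => (qp_pos h0' h1' n).ne'
  have hC := cauchy_binom h0' h1' (q ^ (5 * N + 1)) (2 * N + 1)
  rw [prod_side] at hC
  have hne : (-1 : ℝ) ^ (N + 1) * q ^ (5 * Nat.choose (N + 1) 2 + (5 * N + 1) * N) ≠ 0 := by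
    have : q ≠ 0 := h0.ne'
    positivity
  refine mul_left_cancel₀ hne (hC.trans ?_)
  have hs : 2 * N + 1 + 1 = (N + 1) + (N + 1) := by omega
  rw [hs, Finset.sum_range_add, ← Finset.sum_range_reflect, ← Finset.sum_add_distrib,
    Finset.mul_sum, Finset.mul_sum]
  refine Finset.sum_congr rfl fun j hj => ?_
  obtain ⟨m, rfl⟩ : ∃ m, N = j + m := ⟨N - j, by simp at hj; omega⟩
  have e1 : j + m + 1 - 1 - j = m := by omega
  have e2 : 2 * (j + m) + 1 - m = j + m + j + 1 := by omega
  have e3 : j + m + 1 + j = j + m + j + 1 := by omega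
  have e4 : 2 * (j + m) + 1 - (j + m + j + 1) = m := by omega
  have e5 : j + m - j = m := by omega
  rw [e1, e2, e3, e4, e5]
  have t1 := tri (j + m)
  have t2 := tri (j + m + j)
  have t3 := tri j
  have t4 := tri m
  rw [tri_succ j] at t3
  rw [tri_succ m] at t4
  have x1 : (5 * (j + m) + 1) * (j + m + j + 1) + 5 * Nat.choose m 2 =
      (5 * Nat.choose (j + m + 1) 2 + (5 * (j + m) + 1) * (j + m)) + (j ^ 2 + j) + (j ^ 2 + j) +
        Nat.choose j 2 + (2 * j + 1) := by
    zify at *; linarith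
  have x2 : (5 * (j + m) + 1) * m + 5 * Nat.choose (j + m + j + 1) 2 =
      (5 * Nat.choose (j + m + 1) 2 + (5 * (j + m) + 1) * (j + m)) + (j ^ 2 + j) + (j ^ 2 + j) +
        Nat.choose j 2 := by
    zify at *; linarith
  have y1 : (q ^ (5 * (j + m) + 1)) ^ (j + m + j + 1) * (q ^ 5) ^ (Nat.choose m 2) =
      q ^ (5 * Nat.choose (j + m + 1) 2 + (5 * (j + m) + 1) * (j + m)) * q ^ (j ^ 2 + j) *
        q ^ (j ^ 2 + j) * q ^ (Nat.choose j 2) * q ^ (2 * j + 1) := by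
    rw [← pow_mul, ← pow_mul, ← pow_add, x1, pow_add, pow_add, pow_add, pow_add]
  have y2 : (q ^ (5 * (j + m) + 1)) ^ m * (q ^ 5) ^ (Nat.choose (j + m + j + 1) 2) =
      q ^ (5 * Nat.choose (j + m + 1) 2 + (5 * (j + m) + 1) * (j + m)) * q ^ (j ^ 2 + j) *
        q ^ (j ^ 2 + j) * q ^ (Nat.choose j 2) := by
    rw [← pow_mul, ← pow_mul, ← pow_add, x2, pow_add, pow_add, pow_add]
  have s1 : (-1 : ℝ) ^ m = - ((-1) ^ (j + m + 1) * (-1) ^ j) := by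
    have : (-1 : ℝ) ^ j * (-1) ^ j = 1 := by rw [← mul_pow]; simp
    rw [pow_succ, pow_add]; linear_combination -(-1 : ℝ) ^ m * this
  have s2 : (-1 : ℝ) ^ (j + m + j + 1) = (-1) ^ (j + m + 1) * (-1) ^ j := by ring
  rw [mul_assoc ((-1 : ℝ) ^ m), mul_assoc ((-1 : ℝ) ^ (j + m + j + 1)), y1, y2, s1, s2]
  ring

theorem mult_fac {x : ℝ} (h0 : 0 < x) (h1 : x < 1) (f : ℕ → ℕ) (hf : ∀ n, n < f n) :
    Multipliable (fun n => (1 - x ^ f n)) ∧ Multipliable (fun n => (1 - x ^ f n)⁻¹) := by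
  have hs : Summable fun n => x ^ f n :=
    Summable.of_nonneg_of_le (fun n => by positivity)
      (fun n => pow_le_pow_of_le_one h0.le h1.le (hf n).le)
      (summable_geometric_of_lt_one h0.le h1)
  have hx : ∀ n, x ^ f n ≤ x := fun n => by
    simpa using pow_le_pow_of_le_one h0.le h1.le (show 1 ≤ f n by have := hf n; omega)
  constructor
  · simpa [sub_eq_add_neg] using Real.multipliable_one_add_of_summable hs.neg
  · have h2 : Summable fun n => x ^ f n / (1 - x ^ f n) := by
      refine Summable.of_nonneg_of_le (fun n => ?_) (fun n => ?_) (hs.mul_right (1 - x)⁻¹)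
      · have := hx n
        exact div_nonneg (by positivity) (by linarith)
      · rw [div_eq_mul_inv]
        have := hx n
        gcongr
    convert Real.multipliable_one_add_of_summable h2 using 2 with n
    have : 1 - x ^ f n ≠ 0 := by have := hx n; linarith
    field_simp
    try ring

theorem qp_lim {x : ℝ} (h0 : 0 < x) (h1 : x < 1) :
    ∃ L C : ℝ, L ≠ 0 ∧ Tendsto (qp x) atTop (𝓝 L) ∧ (∀ n, (qp x n)⁻¹ ≤ C) := by
  obtain ⟨m1, m2⟩ := mult_fac h0 h1 (fun n => n + 1) (fun n => by omega)
  have t1 := m1.hasProd.tendsto_prod_nat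
  have t2 := m2.hasProd.tendsto_prod_nat
  simp only [Finset.prod_inv_distrib] at t2
  have t3 := t1.mul t2
  have : ∀ n, qp x n ≠ 0 := fun n => (qp_pos h0 h1 n).ne'
  have t4 : Tendsto (fun _ : ℕ => (1 : ℝ)) atTop _ := t3.congr fun n => mul_inv_cancel₀ (this n)
  have h := tendsto_nhds_unique t4 tendsto_const_nhds
  obtain ⟨C, hC⟩ := t2.bddAbove_range
  exact ⟨_, C, left_ne_zero_of_mul (h ▸ one_ne_zero), t1, fun n => hC ⟨n, rfl⟩⟩

theorem qp_le_one {x : ℝ} (h0 : 0 < x) (h1 : x < 1) (n : ℕ) : qp x n ≤ 1 :=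
  Finset.prod_le_one (fun j _ => (fac_pos h0 h1 j).le) fun j _ => by
    have : 0 < x ^ (j + 1) := by positivity
    linarith

theorem tannery (a : ℕ → ℝ) (ha : Summable fun n => |a n|) (c : ℕ → ℕ → ℝ) (C l : ℝ)
    (hb : ∀ N j, |c N j| ≤ C) (hl : ∀ j, Tendsto (fun N => c N j) atTop (𝓝 l)) :
    Tendsto (fun N => ∑ j ∈ Finset.range (N + 1), a j * c N j) atTop (𝓝 ((∑' j, a j) * l)) := by
  have h : Tendsto (fun N => ∑' j, if j ∈ Finset.range (N + 1) then a j * c N j else 0) atTop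
      (𝓝 (∑' j, a j * l)) := by
    refine tendsto_tsum_of_dominated_convergence (bound := fun j => |a j| * C)
      (ha.mul_right C) (fun j => ?_) (Eventually.of_forall fun N j => ?_)
    · refine ((hl j).const_mul (a j)).congr' ?_
      filter_upwards [eventually_ge_atTop j] with N hN
      rw [if_pos (by simp; omega)]
    · have h2 : |a j * c N j| ≤ |a j| * C := by
        rw [abs_mul]; exact mul_le_mul_of_nonneg_left (hb N j) (abs_nonneg _)
      split_ifs
      · exact h2
      · simpa using (abs_nonneg _).trans h2
  rw [tsum_mul_right] at h
  refine h.congr fun N => ?_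
  rw [tsum_eq_sum (s := Finset.range (N + 1)) (fun j hj => if_neg hj)]
  exact Finset.sum_congr rfl fun j hj => if_pos hj

theorem qp_five (q : ℝ) (N : ℕ) : qp q (5 * N) = qp (q ^ 5) N *
    (∏ n ∈ Finset.range N, ((1 - q ^ (5 * n + 1)) * (1 - q ^ (5 * n + 4)))) *
    ∏ n ∈ Finset.range N, ((1 - q ^ (5 * n + 3)) * (1 - q ^ (5 * n + 2))) := by
  induction N with
  | zero => simp [qp_zero]
  | succ N ih =>
    have e : 5 * (N + 1) = 5 * N + 1 + 1 + 1 + 1 + 1 := by omega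
    rw [e]
    simp only [qp_succ, ih, Finset.prod_range_succ]
    ring

/-- The second Rogers–Ramanujan identity: for `0 < q < 1`,
`1 + ∑_{n=1}^∞ q^{n(n+1)}/((1−q)(1−q²)⋯(1−qⁿ)) = ∏_{n=1}^∞ 1/((1−q^{5n−2})(1−q^{5n−3}))`. -/
theorem rogers_ramanujan_second (q : ℝ) (h0 : 0 < q) (h1 : q < 1) :
    1 + ∑' n : ℕ, q ^ ((n + 1) * (n + 2)) / ∏ j ∈ Finset.range (n + 1), (1 - q ^ (j + 1)) =
      ∏' n : ℕ, ((1 - q ^ (5 * n + 3)) * (1 - q ^ (5 * n + 2)))⁻¹ := by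
  have h0' : 0 < q ^ 5 := by positivity
  have h1' : q ^ 5 < 1 := pow_lt_one₀ h0.le h1 (by norm_num)
  have hp : ∀ n, qp q n ≠ 0 := fun n => (qp_pos h0 h1 n).ne'
  have hp' : ∀ n, qp (q ^ 5) n ≠ 0 := fun n => (qp_pos h0' h1' n).ne'
  have hi : ∀ n, 0 < (qp q n)⁻¹ := fun n => inv_pos.2 (qp_pos h0 h1 n)
  have hi' : ∀ n, 0 < (qp (q ^ 5) n)⁻¹ := fun n => inv_pos.2 (qp_pos h0' h1' n)
  obtain ⟨P, C, hP, tP, hC⟩ := qp_lim h0 h1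
  obtain ⟨P', C', hP', tP', hC'⟩ := qp_lim h0' h1'
  have hC0 : 0 ≤ C := (hi 0).le.trans (hC 0)
  have hC0' : 0 ≤ C' := (hi' 0).le.trans (hC' 0)
  have hgeo := summable_geometric_of_lt_one h0.le h1
  have hqle : ∀ n m : ℕ, n ≤ m → q ^ m ≤ q ^ n := fun n m h => pow_le_pow_of_le_one h0.le h1.le h
  set b : ℕ → ℝ := fun s => q ^ (s ^ 2 + s) * (1 / qp q s) with hbdef
  set a : ℕ → ℝ := fun j => q ^ (j ^ 2 + j) * (q ^ (j ^ 2 + j) *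
        ((-1) ^ j * q ^ (Nat.choose j 2) * (1 - q ^ (2 * j + 1)))) with hadef
  have hb : Summable fun n => |b n| := by
    refine Summable.of_nonneg_of_le (fun n => abs_nonneg _) (fun n => ?_) (hgeo.mul_right C)
    rw [hbdef]
    simp only [one_div]
    rw [abs_of_nonneg (mul_nonneg (by positivity) (hi n).le)]
    exact mul_le_mul (hqle _ _ (by omega)) (hC n) (hi n).le (by positivity)
  have ha : Summable fun n => |a n| := by
    refine Summable.of_nonneg_of_le (fun n => abs_nonneg _) (fun n => ?_) hgeo
    simp only [hadef, abs_mul, abs_pow, abs_neg, abs_one, one_pow, one_mul, abs_of_pos h0,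
      abs_of_pos (fac_pos h0 h1 (2 * n))]
    have hq1 : ∀ m, q ^ m ≤ 1 := fun m => pow_le_one₀ h0.le h1.le
    have k1 : 1 - q ^ (2 * n + 1) ≤ 1 := by
      have : 0 < q ^ (2 * n + 1) := by positivity
      linarith
    have k0 := (fac_pos h0 h1 (2 * n)).le
    calc _ ≤ q ^ n * (1 * (1 * 1)) := by
          refine mul_le_mul (hqle _ _ (by omega)) ?_ (by positivity) (by positivity)
          refine mul_le_mul (hq1 _) ?_ (by positivity) (by positivity)
          exact mul_le_mul (hq1 _) k1 k0 (by positivity)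
      _ = q ^ n := by ring
  have shift : ∀ j : ℕ, Tendsto (fun N => N - j) atTop atTop := fun j => tendsto_sub_atTop_nat j
  have shift2 : ∀ j : ℕ, Tendsto (fun N => N + j + 1) atTop atTop := fun j =>
    tendsto_atTop_mono (fun N => by simp only [id]; omega) tendsto_id
  have L1 := tannery b hb (fun N s => (qp q (N - s))⁻¹) C P⁻¹
    (fun N j => by rw [abs_of_pos (hi _)]; exact hC _)
    (fun j => (tP.comp (shift j)).inv₀ hP)
  have L2 := tannery a ha (fun N j => (qp q (N - j))⁻¹ * (qp q (N + j + 1))⁻¹) (C * C)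
    (P⁻¹ * P⁻¹)
    (fun N j => by
      rw [abs_of_pos (mul_pos (hi _) (hi _))]
      exact mul_le_mul (hC _) (hC _) (hi _).le hC0)
    (fun j => ((tP.comp (shift j)).inv₀ hP).mul ((tP.comp (shift2 j)).inv₀ hP))
  have L3 := tannery a ha
    (fun N j => qp (q ^ 5) (2 * N + 1) * ((qp (q ^ 5) (N - j))⁻¹ * (qp (q ^ 5) (N + j + 1))⁻¹))
    (1 * (C' * C')) (P' * (P'⁻¹ * P'⁻¹))
    (fun N j => by
      rw [abs_of_pos (mul_pos (qp_pos h0' h1' _) (mul_pos (hi' _) (hi' _)))]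
      exact mul_le_mul (qp_le_one h0' h1' _) (mul_le_mul (hC' _) (hC' _) (hi' _).le hC0')
        (mul_pos (hi' _) (hi' _)).le zero_le_one)
    (fun j => (tP'.comp (tendsto_atTop_mono (fun N => by simp only [id]; omega) tendsto_id)).mul
      (((tP'.comp (shift j)).inv₀ hP').mul ((tP'.comp (shift2 j)).inv₀ hP')))
  have E1 : (∑' j, a j) * (P⁻¹ * P⁻¹) = (∑' j, b j) * P⁻¹ := by
    refine tendsto_nhds_unique (L2.congr fun N => ?_) L1
    have := finite_rr h0 h1 N
    simp only [div_eq_mul_inv, mul_inv] at this ⊢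
    simpa only [hadef, hbdef, one_div, one_mul] using this
  have E1' : (∑' j, b j) = (∑' j, a j) * P⁻¹ := by
    field_simp at E1 ⊢
    linarith
  have E2 : 1 + ∑' n : ℕ, q ^ ((n + 1) * (n + 2)) / ∏ j ∈ Finset.range (n + 1), (1 - q ^ (j + 1))
      = ∑' j, b j := by
    rw [hb.of_abs.tsum_eq_zero_add]
    congr 1
    · simp [hbdef, qp_zero]
    · refine tsum_congr fun n => ?_
      simp only [hbdef, qp]
      rw [mul_one_div]
      congr 2
      ring
  rw [E2, E1']
  have hm : Multipliable fun n : ℕ => ((1 - q ^ (5 * n + 3)) * (1 - q ^ (5 * n + 2)))⁻¹ := by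
    simp only [mul_inv]
    exact (mult_fac h0 h1 (fun n => 5 * n + 3) (fun n => by omega)).2.mul
      (mult_fac h0 h1 (fun n => 5 * n + 2) (fun n => by omega)).2
  have hR := hm.hasProd.tendsto_prod_nat
  refine tendsto_nhds_unique ?_ hR
  have five : Tendsto (fun N : ℕ => 5 * N) atTop atTop :=
    tendsto_atTop_mono (fun N => by simp only [id]; omega) tendsto_id
  have hlast : Tendsto (fun N : ℕ => 1 - q ^ (5 * N + 1)) atTop (𝓝 (1 - 0)) :=
    ((tendsto_pow_atTop_nhds_zero_of_lt_one h0.le h1).comp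
      (tendsto_atTop_mono (fun N => by simp only [id]; omega) tendsto_id)).const_sub 1
  have L4 := ((L3.div hlast (by norm_num)).mul tP').mul ((tP.comp five).inv₀ hP)
  have E3 : (∑' j, a j) * (P' * (P'⁻¹ * P'⁻¹)) / (1 - 0) * P' * P⁻¹ = (∑' j, a j) * P⁻¹ := by
    field_simp
    try ring
  rw [E3] at L4
  refine L4.congr fun N => ?_
  have hJ := finite_jtp h0 h1 N
  have h5 := qp_five q N
  have hf := (fac_pos h0 h1 (5 * N)).ne'
  have hne := hp (5 * N)
  rw [h5] at hne
  have hJ' : (∑ j ∈ Finset.range (N + 1), a j * (qp (q ^ 5) (2 * N + 1) *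
      ((qp (q ^ 5) (N - j))⁻¹ * (qp (q ^ 5) (N + j + 1))⁻¹))) =
      (∏ n ∈ Finset.range N, ((1 - q ^ (5 * n + 1)) * (1 - q ^ (5 * n + 4)))) *
        (1 - q ^ (5 * N + 1)) := by
    rw [hJ]
    simp only [div_eq_mul_inv, mul_inv, hadef]
  simp only [Function.comp, Pi.div_apply]
  rw [hJ', h5, Finset.prod_inv_distrib]
  have n1 := left_ne_zero_of_mul (left_ne_zero_of_mul hne)
  have n2 := right_ne_zero_of_mul (left_ne_zero_of_mul hne)
  have n3 := right_ne_zero_of_mul hne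
  generalize (∏ n ∈ Finset.range N, ((1 - q ^ (5 * n + 1)) * (1 - q ^ (5 * n + 4)))) = A at *
  generalize (∏ n ∈ Finset.range N, ((1 - q ^ (5 * n + 3)) * (1 - q ^ (5 * n + 2)))) = B at *
  field_simp
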